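/- arXiv:1307.8025 — 2 statements merged into one kernel-verified Lean document; each statement's English description precedes it below -/
import Mathlib

section
/- Let l > 0. For every continuously differentiable function u : [0,l] → ℝ with zero mean, i.e. ∫₀^l u(x) dx = 0, one has ∫₀^l u(x)² dx ≤ (l/π)² ∫₀^l u'(x)² dx. Moreover the constant (l/π)² is sharp: for every C < (l/π)² there exists a continuously differentiable u : [0,l] → ℝ with ∫₀^l u dx = 0 and ∫₀^l u² dx > C ∫₀^l (u')² dx. -/
open Real MeasureTheory intervalIntegral Set

/-- A suboptimal-constant form of Steklov's inequality. With `F` the primitive of `u` vanishing at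
both endpoints, the sum of squares `(u - k cot(kx + δ) F)² + (k F + u'/k)²` equals
`u'²/k² - u²` plus an exact derivative, and the phase `δ` keeps `cot` regular on `[0, l]`. -/
theorem mul_integral_sq_le_integral_deriv_sq {l k : ℝ} (hl : 0 < l) (hk : 0 < k)
    (hkl : k * l < π) {u u' : ℝ → ℝ}
    (hu : ∀ x ∈ Icc (0 : ℝ) l, HasDerivWithinAt u (u' x) (Icc (0 : ℝ) l) x)
    (hu' : ContinuousOn u' (Icc (0 : ℝ) l)) (hmean : (∫ x in (0 : ℝ)..l, u x) = 0) :
    k ^ 2 * (∫ x in (0 : ℝ)..l, u x ^ 2) ≤ ∫ x in (0 : ℝ)..l, u' x ^ 2 := by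
  have hle := hl.le
  have huc : ContinuousOn u (Icc 0 l) := fun x hx => (hu x hx).continuousWithinAt
  have huI : IntervalIntegrable u volume 0 l := huc.intervalIntegrable_of_Icc hle
  set F : ℝ → ℝ := fun x => ∫ t in (0 : ℝ)..x, u t with hF
  have hFc : ContinuousOn F (Icc 0 l) := by
    have := continuousOn_primitive_interval' huI left_mem_uIcc
    rwa [uIcc_of_le hle] at this
  have hFd : ∀ x ∈ Ioo 0 l, HasDerivAt F (u x) x := by
    intro x hx
    have hsub : Icc 0 l ∈ nhds x := Icc_mem_nhds hx.1 hx.2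
    refine integral_hasDerivAt_right ?_ ?_ (huc.continuousAt hsub)
    · exact (huc.mono (Icc_subset_Icc_right hx.2.le)).intervalIntegrable_of_Icc hx.1.le
    · exact (huc.mono Ioo_subset_Icc_self).stronglyMeasurableAtFilter isOpen_Ioo x hx
  have hF0 : F 0 = 0 := by simp [hF]
  have hFl : F l = 0 := hmean
  set δ : ℝ := (π - k * l) / 2 with hδ
  have hsin : ∀ x ∈ Icc 0 l, sin (k * x + δ) ≠ 0 := by
    intro x hx
    have h1 : 0 ≤ k * x := mul_nonneg hk.le hx.1
    have h2 : k * x ≤ k * l := mul_le_mul_of_nonneg_left hx.2 hk.le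
    exact (sin_pos_of_pos_of_lt_pi (by linarith) (by linarith)).ne'
  set c : ℝ → ℝ := fun x => cos (k * x + δ) / sin (k * x + δ) with hc
  have hcc : ContinuousOn c (Icc 0 l) := ContinuousOn.div (by fun_prop) (by fun_prop) hsin
  have hcd : ∀ x ∈ Icc 0 l, HasDerivAt c (-k * (1 + c x ^ 2)) x := by
    intro x hx
    have hlin : HasDerivAt (fun y => k * y + δ) k x := by
      simpa using ((hasDerivAt_id x).const_mul k).add_const δ
    have hs := hsin x hx
    refine (hlin.cos.div hlin.sin hs).congr_deriv ?_
    simp only [hc]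
    field_simp
    ring
  set S : ℝ → ℝ := fun x => (k * (u x - k * c x * F x)) ^ 2 + (k ^ 2 * F x + u' x) ^ 2
  set H : ℝ → ℝ := fun x => k ^ 2 * (2 * (F x * u x) - k * (c x * F x ^ 2))
  have hexact : (∫ x in (0 : ℝ)..l, (S x - (u' x ^ 2 - k ^ 2 * u x ^ 2))) = H l - H 0 := by
    refine integral_eq_sub_of_hasDerivAt_of_le hle (by fun_prop) ?_
      (ContinuousOn.intervalIntegrable_of_Icc hle (by fun_prop))
    intro x hx
    have hx' := Ioo_subset_Icc_self hx
    have hud := (hu x hx').hasDerivAt (Icc_mem_nhds hx.1 hx.2)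
    refine (((((hFd x hx).mul hud).const_mul 2).sub
      (((hcd x hx').mul ((hFd x hx).pow 2)).const_mul k)).const_mul (k ^ 2)).congr_deriv ?_
    simp only [S, Pi.pow_apply]
    push_cast
    ring
  have hSc : ContinuousOn S (Icc 0 l) := by fun_prop
  have hI1 : IntervalIntegrable (fun x => u' x ^ 2) volume 0 l :=
    (hu'.pow 2).intervalIntegrable_of_Icc hle
  have hI2 : IntervalIntegrable (fun x => k ^ 2 * u x ^ 2) volume 0 l :=
    ((huc.pow 2).intervalIntegrable_of_Icc hle).const_mul _
  rw [integral_sub (hSc.intervalIntegrable_of_Icc hle) (hI1.sub hI2), integral_sub hI1 hI2,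
    intervalIntegral.integral_const_mul] at hexact
  have hSnonneg : 0 ≤ ∫ x in (0 : ℝ)..l, S x :=
    integral_nonneg hle fun x _ => add_nonneg (sq_nonneg _) (sq_nonneg _)
  simp only [H, hF0, hFl] at hexact
  linarith

/-- If `k² A ≤ B` for all `0 < k < a`, then by continuity also `a² A ≤ B`. -/
theorem sq_mul_le_of_forall_lt {a A B : ℝ} (ha : 0 < a)
    (h : ∀ k, 0 < k → k < a → k ^ 2 * A ≤ B) : a ^ 2 * A ≤ B := by
  have hlim : Filter.Tendsto (fun k : ℝ => k ^ 2 * A) (nhdsWithin a (Iio a)) (nhds (a ^ 2 * A)) :=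
    (Continuous.tendsto (by fun_prop) a).mono_left nhdsWithin_le_nhds
  refine le_of_tendsto hlim ?_
  filter_upwards [Ioo_mem_nhdsLT ha] with k hk using h k hk.1 hk.2

/-- **Steklov's inequality (1896).** For `l > 0` and any continuously differentiable
`u : [0,l] → ℝ` with zero mean, `∫₀^l u² ≤ (l/π)² ∫₀^l u'²`, and the constant `(l/π)²`
is sharp. -/
theorem steklov_inequality_zero_mean (l : ℝ) (hl : 0 < l) :
    (∀ u u' : ℝ → ℝ,
        (∀ x ∈ Icc (0 : ℝ) l, HasDerivWithinAt u (u' x) (Icc (0 : ℝ) l) x) →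
        ContinuousOn u' (Icc (0 : ℝ) l) →
        (∫ x in (0 : ℝ)..l, u x) = 0 →
        (∫ x in (0 : ℝ)..l, u x ^ 2) ≤ (l / π) ^ 2 * ∫ x in (0 : ℝ)..l, u' x ^ 2) ∧
    (∀ C : ℝ, C < (l / π) ^ 2 →
      ∃ u u' : ℝ → ℝ,
        (∀ x ∈ Icc (0 : ℝ) l, HasDerivWithinAt u (u' x) (Icc (0 : ℝ) l) x) ∧
        ContinuousOn u' (Icc (0 : ℝ) l) ∧
        (∫ x in (0 : ℝ)..l, u x) = 0 ∧
        (∫ x in (0 : ℝ)..l, u x ^ 2) > C * ∫ x in (0 : ℝ)..l, u' x ^ 2) := by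
  have hk : 0 < π / l := div_pos pi_pos hl
  have hkl : π / l * l = π := div_mul_cancel₀ _ hl.ne'
  have hinv : (l / π) ^ 2 * (π / l) ^ 2 = 1 := by
    field_simp
  refine ⟨fun u u' hu hu' hmean => ?_, fun C hC => ?_⟩
  · have key := sq_mul_le_of_forall_lt hk fun k hk0 hka =>
      mul_integral_sq_le_integral_deriv_sq hl hk0 ((lt_div_iff₀ hl).1 hka) hu hu' hmean
    calc (∫ x in (0 : ℝ)..l, u x ^ 2)
        = (l / π) ^ 2 * ((π / l) ^ 2 * ∫ x in (0 : ℝ)..l, u x ^ 2) := by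
          rw [← mul_assoc, hinv, one_mul]
      _ ≤ _ := mul_le_mul_of_nonneg_left key (sq_nonneg _)
  · set k := π / l with hkdef
    have hcos : (∫ x in (0 : ℝ)..l, cos (k * x) ^ 2) = l / 2 := by
      rw [integral_comp_mul_left (fun y => cos y ^ 2) hk.ne', hkl, mul_zero, integral_cos_sq, hkdef]
      simp
      field_simp
    have hsin : (∫ x in (0 : ℝ)..l, sin (k * x) ^ 2) = l / 2 := by
      rw [integral_comp_mul_left (fun y => sin y ^ 2) hk.ne', hkl, mul_zero, integral_sin_sq, hkdef]
      simp
      field_simp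
    refine ⟨fun x => cos (k * x), fun x => -k * sin (k * x), fun x _ => ?_, by fun_prop, ?_, ?_⟩
    · have hlin : HasDerivAt (fun y => k * y) k x := by
        simpa using (hasDerivAt_id x).const_mul k
      exact (hlin.cos.congr_deriv (by ring)).hasDerivWithinAt
    · rw [integral_comp_mul_left cos hk.ne', hkl]
      simp
    · simp only [mul_pow, neg_sq, intervalIntegral.integral_const_mul, hcos, hsin]
      have hC' : C * k ^ 2 < 1 := hinv ▸ mul_lt_mul_of_pos_right hC (pow_pos hk 2)
      nlinarith
end

section
/- Let 1 < p < ∞ and 1 ≤ q < ∞, let p' = p/(p−1) be the Hölder conjugate of p, and set 𝔉(s) = Γ(s+1)/s^s and C₁(p,q) = 𝔉(1/q + 1/p') / (2 𝔉(1/q) 𝔉(1/p')). Then for every continuously differentiable u : [0,1] → ℝ with u(0) = u(1) = 0 one has (∫₀¹ |u|^q dx)^{1/q} ≤ C₁(p,q) (∫₀¹ |u'|^p dx)^{1/p}, and C₁(p,q) is the smallest constant for which this inequality holds for all such u. -/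
open Real MeasureTheory intervalIntegral Set

/-- `𝔉(s) = Γ(s+1)/s^s`. -/
noncomputable def frakF (s : ℝ) : ℝ := Real.Gamma (s + 1) / s ^ s

/-- Schmidt's sharp constant `C₁(p,q) = 𝔉(1/q + 1/p') / (2 𝔉(1/q) 𝔉(1/p'))`,
where `p' = p/(p-1)`. -/
noncomputable def schmidtC (p q : ℝ) : ℝ :=
  frakF (1 / q + 1 / (p / (p - 1))) / (2 * frakF (1 / q) * frakF (1 / (p / (p - 1))))

theorem integral_rpow_mul_one_sub_rpow {a c : ℝ} (ha : 0 < a) (hc : 0 < c) :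
    ∫ x in (0 : ℝ)..1, x ^ (a - 1) * (1 - x) ^ (c - 1) = ProbabilityTheory.beta a c := by
  rw [ProbabilityTheory.beta_eq_betaIntegralReal a c ha hc, Complex.betaIntegral]
  have h : ∫ x in (0 : ℝ)..1, (x : ℂ) ^ ((a : ℂ) - 1) * (1 - (x : ℂ)) ^ ((c : ℂ) - 1) =
      ∫ x in (0 : ℝ)..1, ((x ^ (a - 1) * (1 - x) ^ (c - 1) : ℝ) : ℂ) := by
    refine intervalIntegral.integral_congr fun x hx => ?_
    rw [uIcc_of_le zero_le_one] at hx
    push_cast [Complex.ofReal_cpow hx.1, Complex.ofReal_cpow (sub_nonneg.2 hx.2)]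
    rfl
  rw [h, intervalIntegral.integral_ofReal, Complex.ofReal_re]

theorem integral_one_sub_rpow_rpow {q c : ℝ} (hq : 0 < q) (hc : 0 < c) :
    ∫ t in (0 : ℝ)..1, (1 - t ^ q) ^ (c - 1) =
      Gamma (1 / q + 1) * Gamma c / Gamma (1 / q + c) := by
  have ha : 0 < 1 / q := by positivity
  have h := integral_comp_rpow_Ioi_of_pos (g := (Iio (1 : ℝ)).indicator
    fun t : ℝ => (1 - t ^ q) ^ (c - 1)) ha
  have hset : Iio (1 : ℝ) ∩ Ioi 0 = Ioo 0 1 := by ext; simp [and_comm]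
  rw [MeasureTheory.integral_indicator measurableSet_Iio,
    Measure.restrict_restrict measurableSet_Iio, hset] at h
  rw [integral_of_le zero_le_one, integral_Ioc_eq_integral_Ioo, ← h]
  have h2 : ∀ x ∈ Ioi (0 : ℝ), (1 / q * x ^ (1 / q - 1)) • (Iio (1 : ℝ)).indicator
      (fun t : ℝ => (1 - t ^ q) ^ (c - 1)) (x ^ (1 / q)) =
      (Iio (1 : ℝ)).indicator
        (fun x => 1 / q * (x ^ (1 / q - 1) * (1 - x) ^ (c - 1))) x := by
    intro x (hx : 0 < x)
    by_cases hx1 : x < 1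
    · rw [indicator_of_mem (show x ^ (1 / q) ∈ Iio 1 from rpow_lt_one hx.le hx1 ha),
        indicator_of_mem (show x ∈ Iio 1 from hx1), ← rpow_mul hx.le,
        one_div_mul_cancel hq.ne', rpow_one, smul_eq_mul, mul_assoc]
    · have : 1 ≤ x ^ (1 / q) := one_le_rpow (not_lt.1 hx1) ha.le
      rw [indicator_of_notMem (by simpa using this), indicator_of_notMem (by simpa using hx1),
        smul_zero]
  rw [setIntegral_congr_fun measurableSet_Ioi h2, MeasureTheory.integral_indicator measurableSet_Iio,
    Measure.restrict_restrict measurableSet_Iio, hset, MeasureTheory.integral_const_mul,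
    ← integral_Ioc_eq_integral_Ioo, ← integral_of_le zero_le_one,
    integral_rpow_mul_one_sub_rpow ha hc, ProbabilityTheory.beta, Gamma_add_one ha.ne']
  ring

theorem integral_one_sub_rpow_rpow_pos {q b : ℝ} (hq : 0 < q) (hb : 0 < b) :
    0 < ∫ t in (0 : ℝ)..1, (1 - t ^ q) ^ b := by
  have h := integral_one_sub_rpow_rpow hq (c := b + 1) (by positivity)
  rw [add_sub_cancel_right] at h
  rw [h]
  have ha : 0 < 1 / q := by positivity
  have h1 := Gamma_pos_of_pos (s := 1 / q + 1) (by positivity)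
  have h2 := Gamma_pos_of_pos (s := b + 1) (by positivity)
  have h3 := Gamma_pos_of_pos (s := 1 / q + (b + 1)) (by positivity)
  positivity

theorem schmidtC_eq {p q : ℝ} (hp : 1 < p) (hq : 0 < q) :
    schmidtC p q = (1 / q) ^ (1 / q) * (1 - 1 / p) ^ (1 - 1 / p) /
      (1 / q + (1 - 1 / p)) ^ (1 / q + (1 - 1 / p)) /
      (2 * ∫ t in (0 : ℝ)..1, (1 - t ^ q) ^ (1 - 1 / p)) := by
  have hb : 1 / (p / (p - 1)) = 1 - 1 / p := by
    have : p - 1 ≠ 0 := by linarith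
    field_simp
  have hb0 : 0 < 1 - 1 / p := by
    rw [sub_pos, div_lt_one (by linarith)]; exact hp
  have ha : 0 < 1 / q := by positivity
  have h := integral_one_sub_rpow_rpow hq (c := (1 - 1 / p) + 1) (by positivity)
  rw [add_sub_cancel_right, ← add_assoc] at h
  rw [h, schmidtC, hb]
  generalize 1 - 1 / p = b at *
  generalize 1 / q = a at *
  have h1 := Gamma_pos_of_pos (s := a + 1) (by positivity)
  have h2 := Gamma_pos_of_pos (s := b + 1) (by positivity)
  have h3 := Gamma_pos_of_pos (s := a + b + 1) (by positivity)
  have h4 : 0 < a ^ a := by positivity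
  have h5 : 0 < b ^ b := by positivity
  have h6 : 0 < (a + b) ^ (a + b) := by positivity
  unfold frakF
  generalize (a + b) ^ (a + b) = z at *
  field_simp

theorem rpow_mul_rpow_le_add_rpow {a b x y : ℝ} (ha : 0 < a) (hb : 0 < b) (hx : 0 ≤ x)
    (hy : 0 ≤ y) :
    x ^ a * y ^ b ≤ a ^ a * b ^ b / (a + b) ^ (a + b) * (x + y) ^ (a + b) := by
  have hab : 0 < a + b := by positivity
  have h := geom_mean_le_arith_mean2_weighted (w₁ := a / (a + b)) (w₂ := b / (a + b))
    (p₁ := x / a) (p₂ := y / b) (by positivity) (by positivity) (by positivity) (by positivity)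
    (by field_simp)
  have h' := rpow_le_rpow (by positivity) h hab.le
  rw [mul_rpow (by positivity) (by positivity), ← rpow_mul (by positivity),
    ← rpow_mul (by positivity), div_mul_cancel₀ _ hab.ne', div_mul_cancel₀ _ hab.ne',
    div_rpow hx ha.le, div_rpow hy hb.le,
    show a / (a + b) * (x / a) + b / (a + b) * (y / b) = (x + y) / (a + b) by field_simp,
    div_rpow (by positivity) hab.le] at h'
  have h4 : 0 < a ^ a := by positivity
  have h5 : 0 < b ^ b := by positivity
  calc x ^ a * y ^ b = a ^ a * b ^ b * (x ^ a / a ^ a * (y ^ b / b ^ b)) := by field_simp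
    _ ≤ a ^ a * b ^ b * ((x + y) ^ (a + b) / (a + b) ^ (a + b)) := by gcongr
    _ = _ := by ring

theorem integral_rpow_sub_rpow_rpow {q b M : ℝ} (hq : 0 < q) (hM : 0 ≤ M) :
    ∫ t in (0 : ℝ)..M, (M ^ q - |t| ^ q) ^ b =
      M * (M ^ q) ^ b * ∫ t in (0 : ℝ)..1, (1 - t ^ q) ^ b := by
  have h := mul_integral_comp_mul_left (a := 0) (b := 1) (f := fun t : ℝ => (M ^ q - |t| ^ q) ^ b) M
  rw [mul_zero, mul_one] at h
  rw [← h, mul_assoc, ← intervalIntegral.integral_const_mul ((M ^ q) ^ b)]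
  congr 1
  refine intervalIntegral.integral_congr fun t ht => ?_
  rw [uIcc_of_le zero_le_one] at ht
  have : t ^ q ≤ 1 := rpow_le_one ht.1 ht.2 hq.le
  rw [abs_of_nonneg (mul_nonneg hM ht.1), mul_rpow hM ht.1, ← mul_rpow (y := 1 - t ^ q)
    (by positivity) (by linarith)]
  congr 1
  ring

theorem abs_integral_le_integral_abs_deriv_mul {u u' Φ : ℝ → ℝ} {c d : ℝ} (hcd : c ≤ d)
    (hu : ∀ x ∈ Icc c d, HasDerivWithinAt u (u' x) (Icc c d) x)
    (hu' : ContinuousOn u' (Icc c d)) (hΦ : Continuous Φ) (hΦ0 : ∀ x ∈ Icc c d, 0 ≤ Φ (u x)) :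
    |∫ t in u c..u d, Φ t| ≤ ∫ x in c..d, |u' x| * Φ (u x) := by
  have huc : ContinuousOn u (Icc c d) := fun x hx => (hu x hx).continuousWithinAt
  rw [← integral_comp_mul_deriv'' (f := u) (f' := u') (by rwa [uIcc_of_le hcd])
    (fun x hx => ?_) (by rwa [uIcc_of_le hcd]) hΦ.continuousOn]
  · refine (abs_integral_le_integral_abs hcd).trans_eq ?_
    refine intervalIntegral.integral_congr fun x hx => ?_
    rw [uIcc_of_le hcd] at hx
    simp only [Function.comp_apply, abs_mul]
    rw [abs_of_nonneg (hΦ0 x hx), mul_comm]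
  · rw [min_eq_left hcd, max_eq_right hcd] at hx
    exact ((hu x (Ioo_subset_Icc_self hx)).hasDerivAt (Icc_mem_nhds hx.1 hx.2)).hasDerivWithinAt

theorem abs_intervalIntegral_zero_of_even {Φ : ℝ → ℝ} (hΦ : ∀ t, Φ (-t) = Φ t) (y : ℝ) :
    |∫ t in 0..y, Φ t| = |∫ t in 0..|y|, Φ t| := by
  rcases abs_choice y with h | h
  · rw [h]
  · have := intervalIntegral.integral_comp_neg (a := 0) (b := y) Φ
    simp only [hΦ, neg_zero] at this
    rw [h, this, intervalIntegral.integral_symm, abs_neg]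

theorem intervalIntegral_mul_le_Lp_mul_Lq {p r : ℝ} (hpr : p.HolderConjugate r) {f g : ℝ → ℝ}
    (hf : ContinuousOn f (Icc 0 1)) (hg : ContinuousOn g (Icc 0 1))
    (hf0 : ∀ x ∈ Icc (0 : ℝ) 1, 0 ≤ f x) (hg0 : ∀ x ∈ Icc (0 : ℝ) 1, 0 ≤ g x) :
    ∫ x in (0 : ℝ)..1, f x * g x ≤
      (∫ x in (0 : ℝ)..1, f x ^ p) ^ (1 / p) * (∫ x in (0 : ℝ)..1, g x ^ r) ^ (1 / r) := by
  have hL : ∀ {h : ℝ → ℝ} (s : ENNReal), ContinuousOn h (Icc 0 1) →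
      MemLp h s (volume.restrict (Icc 0 1)) := by
    intro h s hh
    obtain ⟨B, hB⟩ := isCompact_Icc.exists_bound_of_continuousOn hh
    exact MemLp.of_bound (hh.aestronglyMeasurable measurableSet_Icc) B
      (ae_restrict_of_forall_mem measurableSet_Icc hB)
  simp only [integral_of_le zero_le_one, ← integral_Icc_eq_integral_Ioc]
  exact integral_mul_le_Lp_mul_Lq_of_nonneg hpr
    (ae_restrict_of_forall_mem measurableSet_Icc hf0)
    (ae_restrict_of_forall_mem measurableSet_Icc hg0) (hL _ hf) (hL _ hg)

theorem schmidt_inequality {p q : ℝ} (hp : 1 < p) (hq : 0 < q) {u u' : ℝ → ℝ}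
    (hu : ∀ x ∈ Icc (0 : ℝ) 1, HasDerivWithinAt u (u' x) (Icc (0 : ℝ) 1) x)
    (hu' : ContinuousOn u' (Icc (0 : ℝ) 1)) (h0 : u 0 = 0) (h1 : u 1 = 0) :
    (∫ x in (0 : ℝ)..1, |u x| ^ q) ^ (1 / q) ≤
      schmidtC p q * (∫ x in (0 : ℝ)..1, |u' x| ^ p) ^ (1 / p) := by
  have huc : ContinuousOn u (Icc 0 1) := fun x hx => (hu x hx).continuousWithinAt
  obtain ⟨x₀, hx₀, hmax⟩ := isCompact_Icc.exists_isMaxOn (nonempty_Icc.2 zero_le_one) huc.abs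
  rw [schmidtC_eq hp hq]
  have hb0 : 0 < 1 - 1 / p := by
    rw [sub_pos, div_lt_one (by linarith)]; exact hp
  have hconj : p.HolderConjugate (1 / (1 - 1 / p)) := by
    rw [Real.holderConjugate_iff]
    exact ⟨hp, by simp⟩
  have ha0 : 0 < 1 / q := by positivity
  have hK := integral_one_sub_rpow_rpow_pos hq hb0
  set b := 1 - 1 / p with hb
  set K := ∫ t in (0 : ℝ)..1, (1 - t ^ q) ^ b with hKdef
  set M := |u x₀| with hM
  have hM0 : 0 ≤ M := abs_nonneg _
  have hle : ∀ x ∈ Icc (0 : ℝ) 1, |u x| ^ q ≤ M ^ q := fun x hx =>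
    rpow_le_rpow (abs_nonneg _) (hmax hx) hq.le
  set Φ : ℝ → ℝ := fun t => (M ^ q - |t| ^ q) ^ b with hΦdef
  have hΦ : Continuous Φ := by
    refine Continuous.rpow_const ?_ fun _ => Or.inr hb0.le
    exact continuous_const.sub (continuous_abs.rpow_const fun _ => Or.inr hq.le)
  have hΦ0 : ∀ x ∈ Icc (0 : ℝ) 1, 0 ≤ Φ (u x) := fun x hx =>
    rpow_nonneg (sub_nonneg.2 (hle x hx)) _
  have hΦe : ∀ t, Φ (-t) = Φ t := fun t => by simp [hΦdef]
  have hΦK : ∫ t in (0 : ℝ)..M, Φ t = M * (M ^ q) ^ b * K := integral_rpow_sub_rpow_rpow hq hM0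
  have hΦabs : |∫ t in (0 : ℝ)..u x₀, Φ t| = M * (M ^ q) ^ b * K := by
    rw [abs_intervalIntegral_zero_of_even hΦe, ← hM, hΦK, abs_of_nonneg (by positivity)]
  have hs1 : Icc 0 x₀ ⊆ Icc (0 : ℝ) 1 := Icc_subset_Icc_right hx₀.2
  have hs2 : Icc x₀ 1 ⊆ Icc (0 : ℝ) 1 := Icc_subset_Icc_left hx₀.1
  have hleft := abs_integral_le_integral_abs_deriv_mul (Φ := Φ) hx₀.1
    (fun x hx => (hu x (hs1 hx)).mono hs1) (hu'.mono hs1) hΦ (fun x hx => hΦ0 x (hs1 hx))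
  have hright := abs_integral_le_integral_abs_deriv_mul (Φ := Φ) hx₀.2
    (fun x hx => (hu x (hs2 hx)).mono hs2) (hu'.mono hs2) hΦ (fun x hx => hΦ0 x (hs2 hx))
  rw [h0, hΦabs] at hleft
  rw [h1, intervalIntegral.integral_symm, abs_neg, hΦabs] at hright
  have hcont : ContinuousOn (fun x => |u' x| * Φ (u x)) (Icc 0 1) :=
    hu'.abs.mul (hΦ.comp_continuousOn huc)
  have hadd := intervalIntegral.integral_add_adjacent_intervals (μ := volume)
    ((hcont.mono hs1).intervalIntegrable_of_Icc hx₀.1)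
    ((hcont.mono hs2).intervalIntegrable_of_Icc hx₀.2)
  have hH := intervalIntegral_mul_le_Lp_mul_Lq hconj hu'.abs (hΦ.comp_continuousOn huc)
    (fun x _ => abs_nonneg _) hΦ0
  have huq : ContinuousOn (fun x => |u x| ^ q) (Icc 0 1) :=
    huc.abs.rpow_const fun _ _ => Or.inr hq.le
  have hA : ∫ x in (0 : ℝ)..1, (Φ ∘ u) x ^ (1 / b) =
      M ^ q - ∫ x in (0 : ℝ)..1, |u x| ^ q := by
    rw [show M ^ q = ∫ x in (0 : ℝ)..1, M ^ q by simp,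
      ← intervalIntegral.integral_sub (by simp) (huq.intervalIntegrable_of_Icc zero_le_one)]
    refine intervalIntegral.integral_congr fun x hx => ?_
    rw [uIcc_of_le zero_le_one] at hx
    simp only [Function.comp_apply, hΦdef]
    rw [← rpow_mul (sub_nonneg.2 (hle x hx)), mul_one_div_cancel hb0.ne', rpow_one]
  have hA0 : 0 ≤ ∫ x in (0 : ℝ)..1, |u x| ^ q :=
    intervalIntegral.integral_nonneg zero_le_one fun x _ => by positivity
  have hA1 : 0 ≤ ∫ x in (0 : ℝ)..1, (Φ ∘ u) x ^ (1 / b) :=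
    intervalIntegral.integral_nonneg zero_le_one fun x hx => rpow_nonneg (hΦ0 x hx) _
  have hN0 : 0 ≤ ∫ x in (0 : ℝ)..1, |u' x| ^ p :=
    intervalIntegral.integral_nonneg zero_le_one fun x _ => by positivity
  rw [hA] at hH hA1
  simp only [Function.comp_apply, one_div_one_div] at hH
  set A := ∫ x in (0 : ℝ)..1, |u x| ^ q
  set N := (∫ x in (0 : ℝ)..1, |u' x| ^ p) ^ (1 / p) with hN
  have hN0' : 0 ≤ N := by positivity
  have hM1 : M * (M ^ q) ^ b = (M ^ q) ^ (1 / q + b) := by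
    rw [rpow_add_of_nonneg (by positivity) ha0.le hb0.le, ← rpow_mul hM0 q (1 / q),
      mul_one_div_cancel hq.ne', rpow_one]
  have hkey : 2 * K * (M ^ q) ^ (1 / q + b) ≤ N * (M ^ q - A) ^ b := by
    rw [← hM1]; linarith
  have ham := rpow_mul_rpow_le_add_rpow ha0 hb0 hA0 hA1
  rw [add_sub_cancel] at ham
  set D := (1 / q) ^ (1 / q) * b ^ b / (1 / q + b) ^ (1 / q + b)
  have hD : 0 < D := by positivity
  rcases hA1.eq_or_lt with hz | hz
  · rw [← hz, zero_rpow hb0.ne', mul_zero] at hkey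
    have hMz : (M ^ q) ^ (1 / q + b) ≤ 0 := by
      by_contra! h
      have : 0 < 2 * K * (M ^ q) ^ (1 / q + b) := by positivity
      linarith
    rw [← hM1] at hMz
    have hM00 : M = 0 := by
      by_contra h
      have : 0 < M := lt_of_le_of_ne hM0 (Ne.symm h)
      have : 0 < M * (M ^ q) ^ b := by positivity
      linarith
    have : A = 0 := by
      rw [hM00, zero_rpow hq.ne'] at hz
      linarith
    rw [this, zero_rpow ha0.ne']
    positivity
  · have hzb : 0 < (M ^ q - A) ^ b := by positivity
    refine le_of_mul_le_mul_right ?_ hzb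
    calc A ^ (1 / q) * (M ^ q - A) ^ b ≤ D * (M ^ q) ^ (1 / q + b) := ham
      _ = D / (2 * K) * (2 * K * (M ^ q) ^ (1 / q + b)) := by field_simp
      _ ≤ D / (2 * K) * (N * (M ^ q - A) ^ b) := by gcongr
      _ = _ := by ring

theorem intervalIntegrable_one_sub_rpow_rpow {q b : ℝ} (hq : 0 < q) (hb : 0 < b) :
    IntervalIntegrable (fun t : ℝ => (1 - t ^ q) ^ (b - 1)) volume 0 1 := by
  by_contra h
  have h0 := integral_one_sub_rpow_rpow hq hb
  rw [intervalIntegral.integral_undef h] at h0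
  have ha : 0 < 1 / q := by positivity
  have h1 := Gamma_pos_of_pos (s := 1 / q + 1) (by positivity)
  have h2 := Gamma_pos_of_pos hb
  have h3 := Gamma_pos_of_pos (s := 1 / q + b) (by positivity)
  have : 0 < Gamma (1 / q + 1) * Gamma b / Gamma (1 / q + b) := by positivity
  linarith

theorem add_mul_integral_one_sub_rpow_rpow {q b : ℝ} (hq : 0 < q) (hb : 0 < b) :
    (1 / q + b) * ∫ t in (0 : ℝ)..1, (1 - t ^ q) ^ b =
      b * ∫ t in (0 : ℝ)..1, (1 - t ^ q) ^ (b - 1) := by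
  have h := integral_one_sub_rpow_rpow hq (c := b + 1) (by positivity)
  rw [add_sub_cancel_right] at h
  have ha : 0 < 1 / q := by positivity
  have h3 := Gamma_pos_of_pos (s := 1 / q + b) (by positivity)
  rw [h, integral_one_sub_rpow_rpow hq hb, ← add_assoc,
    Gamma_add_one (s := 1 / q + b) (by positivity), Gamma_add_one hb.ne']
  generalize 1 / q = a at *
  field_simp

/-- The generalized sine function, as an inverse of the generalized arcsine. -/
theorem exists_generalized_sine {q b : ℝ} (hq : 0 < q) (hb : 0 < b) (hb1 : b ≤ 1) :
    ∃ w : ℝ → ℝ, Continuous w ∧ Monotone w ∧ w 0 = 0 ∧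
      w (∫ t in (0 : ℝ)..1, (1 - t ^ q) ^ (b - 1)) = 1 ∧
      ∀ x < ∫ t in (0 : ℝ)..1, (1 - t ^ q) ^ (b - 1),
        HasDerivAt w ((1 - (max (w x) 0) ^ q) ^ (1 - b)) x := by
  set T := ∫ t in (0 : ℝ)..1, (1 - t ^ q) ^ (b - 1) with hT
  set k : ℝ → ℝ := fun t => (1 - (max t 0) ^ q) ^ (b - 1) - 1 with hk
  set h : ℝ → ℝ := (Iio 1).indicator k with hh
  have hlt : ∀ {t : ℝ}, t < 1 → (max t 0) ^ q < 1 := fun ht =>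
    rpow_lt_one (le_max_right _ _) (max_lt ht one_pos) hq
  have hk' : ∀ {t : ℝ}, 0 ≤ t → k t = (1 - t ^ q) ^ (b - 1) - 1 := fun ht => by
    simp only [hk, max_eq_left ht]
  have hk0 : ∀ {t : ℝ}, t ≤ 0 → k t = 0 := fun ht => by
    simp [hk, max_eq_right ht, zero_rpow hq.ne']
  have hkint : IntervalIntegrable (fun t : ℝ => (1 - t ^ q) ^ (b - 1) - 1) volume 0 1 :=
    (intervalIntegrable_one_sub_rpow_rpow hq hb).sub (by simp)
  have hhIoo : h = (Ioo 0 1).indicator fun t : ℝ => (1 - t ^ q) ^ (b - 1) - 1 := by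
    ext t
    rcases lt_or_ge t 1 with h1 | h1
    · rw [hh, indicator_of_mem (show t ∈ Iio 1 from h1)]
      rcases lt_or_ge 0 t with h0 | h0
      · rw [indicator_of_mem (show t ∈ Ioo 0 1 from ⟨h0, h1⟩), hk' h0.le]
      · rw [indicator_of_notMem (fun h => h0.not_gt h.1), hk0 h0]
    · rw [hh, indicator_of_notMem (by simpa using h1),
        indicator_of_notMem (fun h => h1.not_gt h.2)]
  have hint : Integrable h := by
    rw [hhIoo, integrable_indicator_iff measurableSet_Ioo]
    exact (intervalIntegrable_iff_integrableOn_Ioo_of_le zero_le_one).1 hkint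
  have hnn : ∀ t, 0 ≤ h t := fun t => by
    refine indicator_nonneg (fun t ht => ?_) t
    have h1 := hlt ht
    have h0 : 0 ≤ (max t 0) ^ q := rpow_nonneg (le_max_right _ _) _
    exact sub_nonneg.2 (one_le_rpow_of_pos_of_le_one_of_nonpos (by linarith) (by linarith)
      (by linarith))
  set F : ℝ → ℝ := fun t => t + ∫ s in (0 : ℝ)..t, h s with hF
  have hFc : Continuous F := continuous_id.add (hint.continuous_primitive 0)
  have hFsub : ∀ s t, s ≤ t → t - s ≤ F t - F s := fun s t hst => by
    have h1 := intervalIntegral.integral_interval_sub_left (a := 0) (b := t) (c := s)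
      hint.intervalIntegrable hint.intervalIntegrable
    have h2 : 0 ≤ ∫ x in s..t, h x := intervalIntegral.integral_nonneg hst fun x _ => hnn x
    simp only [hF]
    linarith
  have hFm : StrictMono F := fun s t hst => by
    have := hFsub s t hst.le
    linarith
  have hF0 : F 0 = 0 := by simp [hF]
  have hF1 : F 1 = T := by
    have : ∫ s in (0 : ℝ)..1, h s = ∫ s in (0 : ℝ)..1, ((1 - s ^ q) ^ (b - 1) - 1) := by
      simp only [integral_of_le zero_le_one, integral_Ioc_eq_integral_Ioo]
      refine setIntegral_congr_fun measurableSet_Ioo fun t ht => ?_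
      rw [hhIoo, indicator_of_mem ht]
    simp only [hF]
    rw [this, intervalIntegral.integral_sub (intervalIntegrable_one_sub_rpow_rpow hq hb)
      (by simp), ← hT]
    simp
  have hFs : Function.Surjective F := by
    refine hFc.surjective ?_ ?_
    · refine Filter.tendsto_atTop_mono' _ ?_ Filter.tendsto_id
      filter_upwards [Filter.eventually_ge_atTop 0] with t ht
      have := hFsub 0 t ht
      simp only [id_eq]
      linarith
    · refine Filter.tendsto_atBot_mono' _ ?_ Filter.tendsto_id
      filter_upwards [Filter.eventually_le_atBot 0] with t ht
      have := hFsub t 0 ht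
      simp only [id_eq]
      linarith
  have hFd : ∀ t < 1, HasDerivAt F ((1 - (max t 0) ^ q) ^ (b - 1)) t := fun t ht => by
    have hkc : ContinuousAt k t := by
      refine ContinuousAt.sub (ContinuousAt.rpow_const ?_ (Or.inl ?_)) continuousAt_const
      · refine continuousAt_const.sub (Continuous.continuousAt ?_)
        exact (continuous_id.max continuous_const).rpow_const fun _ => Or.inr hq.le
      · exact (sub_pos.2 (hlt ht)).ne'
    have hev : h =ᶠ[nhds t] k := by
      filter_upwards [Iio_mem_nhds ht] with s hs
      rw [hh, indicator_of_mem hs]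
    have hd := (hasDerivAt_id t).add (intervalIntegral.integral_hasDerivAt_right (a := 0)
      hint.intervalIntegrable
      (hint.aestronglyMeasurable.stronglyMeasurableAtFilter) (hkc.congr hev.symm))
    rw [hev.eq_of_nhds, show 1 + k t = (1 - (max t 0) ^ q) ^ (b - 1) from add_sub_cancel _ _] at hd
    exact hd
  set e := hFm.orderIsoOfSurjective F hFs
  have hFw : ∀ x, F (e.symm x) = x := fun x => e.apply_symm_apply x
  have hwF : ∀ t, e.symm (F t) = t := fun t => e.symm_apply_apply t
  refine ⟨e.symm, e.symm.continuous, e.symm.monotone, ?_, ?_, fun x hx => ?_⟩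
  · rw [← hF0, hwF, hF0]
  · rw [← hF1, hwF]
  · have hw1 : e.symm x < 1 := by
      rw [← hFm.lt_iff_lt, hFw, hF1]
      exact hx
    have hpos := sub_pos.2 (hlt hw1)
    have := HasDerivAt.of_local_left_inverse e.symm.continuous.continuousAt (hFd _ hw1)
      (rpow_pos_of_pos hpos _).ne' (Filter.Eventually.of_forall hFw)
    rwa [← rpow_neg hpos.le, neg_sub] at this

/-- An extremal function for the inequality, obtained by reflecting a generalized sine. -/
theorem exists_schmidt_extremal {q b : ℝ} (hq : 0 < q) (hb : 0 < b) (hb1 : b < 1) {T : ℝ}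
    (hT : T = ∫ t in (0 : ℝ)..1, (1 - t ^ q) ^ (b - 1)) (hT0 : 0 < T) :
    ∃ v v' : ℝ → ℝ, (∀ x, HasDerivAt v (v' x) x) ∧ Continuous v' ∧ v 0 = 0 ∧ v 1 = 0 ∧
      v (1 / 2) = 1 ∧ (∀ x ∈ Icc (0 : ℝ) 1, v x ∈ Icc (0 : ℝ) 1) ∧
      (∀ x ∈ Icc (0 : ℝ) (1 / 2), v' x = 2 * T * (1 - v x ^ q) ^ (1 - b)) ∧
      (∀ x ∈ Icc (1 / 2 : ℝ) 1, v' x = -(2 * T * (1 - v x ^ q) ^ (1 - b))) := by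
  obtain ⟨w, hwc, hwm, hw0, hwT, hwd⟩ := exists_generalized_sine hq hb hb1.le
  rw [← hT] at hwT hwd
  set v : ℝ → ℝ := fun x => w (T * (1 - |1 - 2 * x|)) with hv
  set G : ℝ → ℝ := fun t => (1 - (max t 0) ^ q) ^ (1 - b) with hG
  set v' : ℝ → ℝ := fun x => if x ≤ 1 / 2 then 2 * T * G (v x) else -(2 * T * G (v x)) with hv'
  have hvc : Continuous v := hwc.comp (by fun_prop)
  have hGc : Continuous G := by
    refine Continuous.rpow_const ?_ fun _ => Or.inr (by linarith)
    exact continuous_const.sub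
      ((continuous_id.max continuous_const).rpow_const fun _ => Or.inr hq.le)
  have hvhalf : v (1 / 2) = 1 := by
    simp only [hv]
    norm_num [hwT]
  have hGv : G (v (1 / 2)) = 0 := by
    rw [hvhalf]
    simp [hG, zero_rpow (sub_pos.2 hb1).ne']
  have hv'c : Continuous v' := by
    refine Continuous.if_le (by fun_prop) (by fun_prop) continuous_id continuous_const ?_
    rintro x rfl
    simp only [hGv, mul_zero, neg_zero]
  have hd : ∀ y ≠ 1 / 2, HasDerivAt v (v' y) y := fun y hy => by
    have habs : |1 - 2 * y| > 0 := abs_pos.2 fun h => hy (by linarith)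
    have hwy := hwd (T * (1 - |1 - 2 * y|)) (by nlinarith)
    rcases hy.lt_or_gt with hlt | hgt
    · have hi : HasDerivAt (fun x : ℝ => T * (1 - |1 - 2 * x|)) (2 * T) y := by
        have : HasDerivAt (fun x : ℝ => 2 * T * x) (2 * T) y := by
          simpa using (hasDerivAt_id y).const_mul (2 * T)
        refine this.congr_of_eventuallyEq ?_
        filter_upwards [Iio_mem_nhds hlt] with x (hx : x < 1 / 2)
        rw [abs_of_nonneg (by linarith)]
        ring
      have := hwy.comp y hi
      simp only [hv', if_pos hlt.le]
      rw [mul_comm]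
      exact this
    · have hi : HasDerivAt (fun x : ℝ => T * (1 - |1 - 2 * x|)) (-(2 * T)) y := by
        have : HasDerivAt (fun x : ℝ => 2 * T + -(2 * T) * x) (-(2 * T)) y := by
          simpa using ((hasDerivAt_id y).const_mul (-(2 * T))).const_add (2 * T)
        refine this.congr_of_eventuallyEq ?_
        filter_upwards [Ioi_mem_nhds hgt] with x (hx : 1 / 2 < x)
        rw [abs_of_nonpos (by linarith)]
        ring
      have := hwy.comp y hi
      simp only [hv', if_neg hgt.not_ge]
      rw [mul_comm, ← mul_neg]
      exact this
  have hmem : ∀ x ∈ Icc (0 : ℝ) 1, v x ∈ Icc (0 : ℝ) 1 := fun x hx => by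
    have h1 : |1 - 2 * x| ≤ 1 := abs_le.2 ⟨by linarith [hx.2], by linarith [hx.1]⟩
    have h0 := abs_nonneg (1 - 2 * x)
    constructor
    · rw [← hw0]
      exact hwm (mul_nonneg hT0.le (by linarith))
    · rw [← hwT]
      exact hwm (by nlinarith)
  have hGm : ∀ x ∈ Icc (0 : ℝ) 1, G (v x) = (1 - v x ^ q) ^ (1 - b) := fun x hx => by
    simp only [hG, max_eq_left (hmem x hx).1]
  refine ⟨v, v', hasDerivAt_of_hasDerivAt_of_ne' hd hvc.continuousAt hv'c.continuousAt, hv'c,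
    ?_, ?_, hvhalf, hmem, fun x hx => ?_, fun x hx => ?_⟩
  · simp [hv, hw0]
  · simp only [hv]
    norm_num [hw0]
  · simp only [hv', if_pos hx.2]
    rw [hGm x ⟨hx.1, by linarith [hx.2]⟩]
  · rw [← hGm x ⟨by linarith [hx.1], hx.2⟩]
    rcases hx.1.eq_or_lt with rfl | h
    · simp only [hv', le_refl, if_true, hGv, mul_zero, neg_zero]
    · simp only [hv', if_neg h.not_ge]

theorem schmidtC_le_of_inequality {p q C : ℝ} (hp : 1 < p) (hq : 0 < q)
    (hC : ∀ u u' : ℝ → ℝ,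
        (∀ x ∈ Icc (0 : ℝ) 1, HasDerivWithinAt u (u' x) (Icc (0 : ℝ) 1) x) →
        ContinuousOn u' (Icc (0 : ℝ) 1) →
        u 0 = 0 → u 1 = 0 →
        (∫ x in (0 : ℝ)..1, |u x| ^ q) ^ (1 / q) ≤
          C * (∫ x in (0 : ℝ)..1, |u' x| ^ p) ^ (1 / p)) :
    schmidtC p q ≤ C := by
  have hp0 : 0 < p := by linarith
  have ha0 : 0 < 1 / q := by positivity
  have hip : 0 < 1 / p := by positivity
  have hb0 : 0 < 1 - 1 / p := by
    rw [sub_pos, div_lt_one hp0]; exact hp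
  rw [schmidtC_eq hp hq]
  have hK := integral_one_sub_rpow_rpow_pos hq hb0
  have hKT := add_mul_integral_one_sub_rpow_rpow hq hb0
  obtain ⟨b, hb⟩ : ∃ b, b = 1 - 1 / p := ⟨_, rfl⟩
  rw [← hb] at hb0 hK hKT ⊢
  obtain ⟨K, hKdef⟩ : ∃ K, K = ∫ t in (0 : ℝ)..1, (1 - t ^ q) ^ b := ⟨_, rfl⟩
  obtain ⟨T, hT⟩ : ∃ T, T = ∫ t in (0 : ℝ)..1, (1 - t ^ q) ^ (b - 1) := ⟨_, rfl⟩
  rw [← hKdef] at hK hKT ⊢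
  rw [← hT] at hKT
  have hT0 : 0 < T := by
    have : 0 < b * T := by rw [← hKT]; positivity
    exact pos_of_mul_pos_right this hb0.le
  obtain ⟨v, v', hd, hv'c, h0, h1, hhalf, hmem, hl, hr⟩ :=
    exists_schmidt_extremal hq hb0 (by linarith) hT hT0
  have hvc : Continuous v := continuous_iff_continuousAt.2 fun x => (hd x).continuousAt
  have hle : ∀ x ∈ Icc (0 : ℝ) 1, 0 ≤ 1 - |v x| ^ q := fun x hx => by
    rw [abs_of_nonneg (hmem x hx).1, sub_nonneg]
    exact rpow_le_one (hmem x hx).1 (hmem x hx).2 hq.le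
  have hvq : Continuous fun x => |v x| ^ q := hvc.abs.rpow_const fun _ => Or.inr hq.le
  set g : ℝ → ℝ := fun s => (1 - |s| ^ q) ^ b with hg
  have hgc : Continuous g := by
    refine Continuous.rpow_const ?_ fun _ => Or.inr hb0.le
    exact continuous_const.sub (continuous_abs.rpow_const fun _ => Or.inr hq.le)
  have hgK : ∫ s in (0 : ℝ)..1, g s = K := by
    rw [hKdef]
    refine intervalIntegral.integral_congr fun s hs => ?_
    rw [uIcc_of_le zero_le_one] at hs
    simp only [hg, abs_of_nonneg hs.1]
  have hmul : ∀ x ∈ Icc (0 : ℝ) 1,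
      g (v x) * (2 * T * (1 - v x ^ q) ^ (1 - b)) = 2 * T * (1 - |v x| ^ q) := fun x hx => by
    have := hle x hx
    simp only [hg]
    rw [← abs_of_nonneg (hmem x hx).1, abs_abs, mul_left_comm,
      ← rpow_add_of_nonneg this hb0.le (by linarith), add_sub_cancel, rpow_one]
  have hI1 : ∫ x in (0 : ℝ)..1 / 2, 2 * T * (1 - |v x| ^ q) = K := by
    have hs := integral_comp_mul_deriv (a := 0) (b := 1 / 2) (fun x _ => hd x) hv'c.continuousOn hgc
    rw [h0, hhalf, hgK] at hs
    rw [← hs]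
    refine intervalIntegral.integral_congr fun x hx => ?_
    rw [uIcc_of_le (by norm_num)] at hx
    simp only [Function.comp_apply, hl x hx]
    rw [hmul x ⟨hx.1, by linarith [hx.2]⟩]
  have hI2 : ∫ x in (1 / 2 : ℝ)..1, 2 * T * (1 - |v x| ^ q) = K := by
    have hs := integral_comp_mul_deriv (a := 1 / 2) (b := 1) (fun x _ => hd x) hv'c.continuousOn hgc
    rw [h1, hhalf, intervalIntegral.integral_symm 0 1, hgK] at hs
    rw [← neg_neg K, ← hs, ← intervalIntegral.integral_neg]
    refine intervalIntegral.integral_congr fun x hx => ?_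
    rw [uIcc_of_le (by norm_num)] at hx
    simp only [Function.comp_apply, hr x hx]
    rw [mul_neg, neg_neg, hmul x ⟨by linarith [hx.1], hx.2⟩]
  obtain ⟨A, hA⟩ : ∃ A, A = ∫ x in (0 : ℝ)..1, |v x| ^ q := ⟨_, rfl⟩
  have hI : ∫ x in (0 : ℝ)..1, (1 - |v x| ^ q) = 1 - A := by
    rw [intervalIntegral.integral_sub (by simp) (hvq.intervalIntegrable _ _), hA]
    simp
  have hTA : T * (1 - A) = K := by
    have hc : Continuous fun x => 2 * T * (1 - |v x| ^ q) := by fun_prop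
    have := intervalIntegral.integral_add_adjacent_intervals (μ := volume)
      (hc.intervalIntegrable 0 (1 / 2)) (hc.intervalIntegrable (1 / 2) 1)
    rw [hI1, hI2, intervalIntegral.integral_const_mul, hI] at this
    linarith
  have hA1 : 1 - A = b / (1 / q + b) := by
    rw [eq_div_iff (by positivity)]
    refine mul_left_cancel₀ hT0.ne' ?_
    linear_combination (1 / q + b) * hTA + hKT
  have hA0 : A = (1 / q) / (1 / q + b) := by
    have : (1 / q) / (1 / q + b) + b / (1 / q + b) = 1 := by field_simp
    linarith
  have hN : ∫ x in (0 : ℝ)..1, |v' x| ^ p = (2 * T) ^ p * (1 - A) := by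
    rw [← hI, ← intervalIntegral.integral_const_mul]
    refine intervalIntegral.integral_congr fun x hx => ?_
    rw [uIcc_of_le zero_le_one] at hx
    have hx0 := hle x hx
    rw [abs_of_nonneg (hmem x hx).1] at hx0
    have habs : |v' x| = 2 * T * (1 - v x ^ q) ^ (1 - b) := by
      rcases le_total x (1 / 2) with h | h
      · rw [hl x ⟨hx.1, h⟩, abs_of_nonneg (by positivity)]
      · rw [hr x ⟨h, hx.2⟩, abs_neg, abs_of_nonneg (by positivity)]
    rw [habs, mul_rpow (by positivity) (by positivity), ← rpow_mul hx0,
      show (1 - b) * p = 1 by rw [hb]; field_simp; ring, rpow_one, abs_of_nonneg (hmem x hx).1]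
  have hA1pos : 0 < 1 - A := by rw [hA1]; positivity
  have hmain := hC v v' (fun x _ => (hd x).hasDerivWithinAt) hv'c.continuousOn h0 h1
  rw [hN, ← hA, mul_rpow (by positivity) hA1pos.le, ← rpow_mul (by positivity),
    mul_one_div_cancel hp0.ne', rpow_one, show 1 / p = 1 - b by linarith] at hmain
  have hD : (1 / q) ^ (1 / q) * b ^ b / (1 / q + b) ^ (1 / q + b) =
      A ^ (1 / q) * (1 - A) ^ b := by
    rw [hA1, hA0, div_rpow ha0.le (by positivity), div_rpow hb0.le (by positivity),
      rpow_add (by positivity : 0 < 1 / q + b)]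
    field_simp
  rw [hD, div_le_iff₀ (by positivity), ← hTA]
  calc A ^ (1 / q) * (1 - A) ^ b
      ≤ C * (2 * T * (1 - A) ^ (1 - b)) * (1 - A) ^ b := by gcongr
    _ = C * (2 * T * ((1 - A) ^ (1 - b) * (1 - A) ^ b)) := by ring
    _ = C * (2 * (T * (1 - A))) := by
      rw [← rpow_add hA1pos, sub_add_cancel, rpow_one]
      ring

/-- **Schmidt's sharp one-dimensional inequality.** For `1 < p < ∞`, `1 ≤ q < ∞` and any
continuously differentiable `u : [0,1] → ℝ` vanishing at the end-points,
`‖u‖_{L^q} ≤ C₁(p,q) ‖u'‖_{L^p}`, and `C₁(p,q)` is the smallest such constant. -/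
theorem schmidt_inequality_sharp (p q : ℝ) (hp : 1 < p) (hq : 1 ≤ q) :
    (∀ u u' : ℝ → ℝ,
        (∀ x ∈ Icc (0 : ℝ) 1, HasDerivWithinAt u (u' x) (Icc (0 : ℝ) 1) x) →
        ContinuousOn u' (Icc (0 : ℝ) 1) →
        u 0 = 0 → u 1 = 0 →
        (∫ x in (0 : ℝ)..1, |u x| ^ q) ^ (1 / q) ≤
          schmidtC p q * (∫ x in (0 : ℝ)..1, |u' x| ^ p) ^ (1 / p)) ∧
    (∀ C : ℝ,
      (∀ u u' : ℝ → ℝ,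
        (∀ x ∈ Icc (0 : ℝ) 1, HasDerivWithinAt u (u' x) (Icc (0 : ℝ) 1) x) →
        ContinuousOn u' (Icc (0 : ℝ) 1) →
        u 0 = 0 → u 1 = 0 →
        (∫ x in (0 : ℝ)..1, |u x| ^ q) ^ (1 / q) ≤
          C * (∫ x in (0 : ℝ)..1, |u' x| ^ p) ^ (1 / p)) →
      schmidtC p q ≤ C) := by
  exact ⟨fun u u' hu hu' h0 h1 => schmidt_inequality hp (by linarith) hu hu' h0 h1,
    fun C hC => schmidtC_le_of_inequality hp (by linarith) hC⟩
end
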